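/- Let n ≥ 2 and let U = (U_1,…,U_n) be uniformly distributed on the unit sphere S^{n−1} ⊂ ℝ^n. Then for every integer r with 1 ≤ r < n and all positive real numbers t_1,…,t_n, P[⋂_{i=1}^n {U_i ≤ t_i}] ≤ P[⋂_{i=1}^r {U_i ≤ t_i}] · P[⋂_{i=r+1}^n {U_i ≤ t_i}]. Consequently P[⋂_{i=1}^n {U_i ≤ t_i}] ≤ ∏_{i=1}^n P[U_i ≤ t_i] (subindependence of coordinate halfspaces). -/

import Mathlib

open MeasureTheory Filter

/-- The group of isometries fixing `Kᗮ` pointwise. -/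
def fixGroup {E : Type*} [NormedAddCommGroup E] [InnerProductSpace ℝ E] [CompleteSpace E]
    (K : Submodule ℝ E) : Subgroup (unitary (E →L[ℝ] E)) where
  carrier := {Q | ∀ v ∈ Kᗮ, Unitary.linearIsometryEquiv Q v = v}
  mul_mem' := by
    intro a b ha hb v hv
    rw [map_mul]
    change Unitary.linearIsometryEquiv a (Unitary.linearIsometryEquiv b v) = v
    rw [hb v hv, ha v hv]
  one_mem' := by intro v _; simp
  inv_mem' := by
    intro a ha v hv
    have h : Unitary.linearIsometryEquiv a⁻¹ (Unitary.linearIsometryEquiv a v) = v := by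
      change (Unitary.linearIsometryEquiv a⁻¹ * Unitary.linearIsometryEquiv a) v = v
      rw [← map_mul]; simp
    rw [ha v hv] at h
    exact h

lemma fixGroup_compact {E : Type*} [NormedAddCommGroup E] [InnerProductSpace ℝ E]
    [CompleteSpace E] [FiniteDimensional ℝ E] (K : Submodule ℝ E) :
    CompactSpace (fixGroup K) := by
  have h1 : IsCompact (unitary (E →L[ℝ] E) : Set (E →L[ℝ] E)) := by
    have : ProperSpace (E →L[ℝ] E) := FiniteDimensional.proper ℝ _
    refine Metric.isCompact_of_isClosed_isBounded isClosed_unitary ?_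
    refine (Metric.isBounded_closedBall (x := (0 : E →L[ℝ] E)) (r := 1)).subset ?_
    intro Q hQ
    rw [mem_closedBall_zero_iff]
    refine ContinuousLinearMap.opNorm_le_bound _ zero_le_one fun x => ?_
    have := (Unitary.linearIsometryEquiv ⟨Q, hQ⟩).norm_map x
    rw [one_mul]
    exact this.le
  have : CompactSpace (unitary (E →L[ℝ] E)) := isCompact_iff_compactSpace.mp h1
  have h2 : IsClosed (fixGroup K : Set (unitary (E →L[ℝ] E))) := by
    have : (fixGroup K : Set (unitary (E →L[ℝ] E))) =
        ⋂ v ∈ Kᗮ, {Q : unitary (E →L[ℝ] E) | (Q : E →L[ℝ] E) v = v} := by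
      ext Q; simp [fixGroup]; rfl
    rw [this]
    refine isClosed_biInter fun v _ => isClosed_eq ?_ continuous_const
    fun_prop
  exact isCompact_iff_compactSpace.mp h2.isCompact

lemma exists_avg {E : Type*} [NormedAddCommGroup E] [InnerProductSpace ℝ E]
    [FiniteDimensional ℝ E] [MeasurableSpace E] [BorelSpace E]
    (μ : Measure E) [IsProbabilityMeasure μ] (hinv : ∀ f : E ≃ₗᵢ[ℝ] E, μ.map f = μ)
    (K : Submodule ℝ E) (A : Set E) (hA : MeasurableSet A)
    (hAK : ∀ u v, u - v ∈ Kᗮ → u ∈ A → v ∈ A)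
    (hstar : ∀ u ∈ A, ∀ c : ℝ, 0 ≤ c → c ≤ 1 → c • u ∈ A) :
    ∃ f : E → ENNReal, Measurable f ∧
      (∀ u v, ‖K.starProjection u‖ ≤ ‖K.starProjection v‖ → f v ≤ f u) ∧
      (∀ k : E → ENNReal, Measurable k → (∀ u v, u - v ∈ K → k u = k v) →
        ∫⁻ u, k u * A.indicator 1 u ∂μ = ∫⁻ u, k u * f u ∂μ) := by
  classical
  have : CompactSpace (fixGroup K) := fixGroup_compact K
  let : MeasurableSpace (fixGroup K) := borel _
  have : BorelSpace (fixGroup K) := ⟨rfl⟩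
  let K₀ : TopologicalSpace.PositiveCompacts (fixGroup K) := ⊤
  let ν : Measure (fixGroup K) := Measure.haarMeasure K₀
  have : IsProbabilityMeasure ν := ⟨by
    have := Measure.haarMeasure_self (K₀ := K₀)
    simpa [K₀] using this⟩
  have : ν.IsMulLeftInvariant := Measure.isMulLeftInvariant_haarMeasure K₀
  let act : fixGroup K → (E ≃ₗᵢ[ℝ] E) := fun Q => Unitary.linearIsometryEquiv (Q : unitary (E →L[ℝ] E))
  have act_mul : ∀ Q R u, act (Q * R) u = act Q (act R u) := by
    intro Q R u; simp [act]
  have act_inv : ∀ Q u, act Q⁻¹ (act Q u) = u := by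
    intro Q u; rw [← act_mul]; simp [act]
  have act_fix : ∀ Q, ∀ v ∈ Kᗮ, act Q v = v := fun Q => Q.2
  have act_sub : ∀ Q u, act Q u - u ∈ K := by
    intro Q u
    rw [← Submodule.orthogonal_orthogonal K, Submodule.mem_orthogonal]
    intro w hw
    rw [inner_sub_right, sub_eq_zero]
    conv_lhs => rw [← act_fix Q w hw]
    exact (act Q).inner_map_map w u
  have hcont : Continuous (fun p : E × fixGroup K => act p.2⁻¹ p.1) := by
    have : Continuous (fun p : E × fixGroup K =>
      (((p.2⁻¹ : fixGroup K) : unitary (E →L[ℝ] E)) : E →L[ℝ] E) p.1) := by fun_prop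
    exact this
  have hind : Measurable (fun p : E × fixGroup K => A.indicator (1 : E → ENNReal) (act p.2⁻¹ p.1)) :=
    (measurable_one.indicator hA).comp hcont.measurable
  have hcu : ∀ u : E, Continuous (fun Q : fixGroup K => act Q⁻¹ u) := by
    intro u
    have : Continuous (fun Q : fixGroup K =>
      (((Q⁻¹ : fixGroup K) : unitary (E →L[ℝ] E)) : E →L[ℝ] E) u) := by fun_prop
    exact this
  have key : ∀ Q u, act Q u - act Q (K.starProjection u) ∈ Kᗮ := by
    intro Q u
    have h := K.sub_starProjection_mem_orthogonal u
    rw [← map_sub, act_fix Q _ h]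
    exact h
  have hAiff : ∀ u v, u - v ∈ Kᗮ → (u ∈ A ↔ v ∈ A) := by
    intro u v h
    refine ⟨hAK u v h, hAK v u ?_⟩
    rw [← neg_sub]; exact Submodule.neg_mem _ h
  refine ⟨fun u => ∫⁻ Q, A.indicator 1 (act Q⁻¹ u) ∂ν, hind.lintegral_prod_right', ?_, ?_⟩
  · intro u v huv
    obtain ⟨c, hc0, hc1, hc⟩ : ∃ c : ℝ, 0 ≤ c ∧ c ≤ 1 ∧
        ‖c • K.starProjection v‖ = ‖K.starProjection u‖ := by
      refine ⟨‖K.starProjection u‖ / ‖K.starProjection v‖, by positivity,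
        div_le_one_of_le₀ huv (norm_nonneg _), ?_⟩
      rw [norm_smul, Real.norm_of_nonneg (by positivity)]
      refine div_mul_cancel_of_imp fun h => ?_
      exact le_antisymm (h ▸ huv) (norm_nonneg _)
    set pu := K.starProjection u with hpu
    set pv := K.starProjection v with hpv
    have hpuK : pu ∈ K := K.starProjection_apply_mem u
    have hpvK : pv ∈ K := K.starProjection_apply_mem v
    let R₀ : E ≃ₗᵢ[ℝ] E := (ℝ ∙ (c • pv - pu))ᗮ.reflection
    have hR₀ : R₀ (c • pv) = pu := Submodule.reflection_sub hc
    let R : fixGroup K := ⟨Unitary.linearIsometryEquiv.symm R₀, by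
      intro w hw
      rw [MulEquiv.apply_symm_apply]
      apply Submodule.reflection_mem_subspace_eq_self
      rw [Submodule.mem_orthogonal_singleton_iff_inner_right]
      exact hw _ (K.sub_mem (K.smul_mem c hpvK) hpuK)⟩
    have hR : act R (c • pv) = pu := by
      have : act R = R₀ := by simp [act, R]
      rw [this, hR₀]
    have hRi : act R⁻¹ pu = c • pv := by rw [← hR, act_inv]
    calc ∫⁻ Q, A.indicator 1 (act Q⁻¹ v) ∂ν
        ≤ ∫⁻ Q, A.indicator 1 (act (R * Q)⁻¹ u) ∂ν := by
          refine lintegral_mono fun Q => ?_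
          by_cases h : act Q⁻¹ v ∈ A
          · have h1 : act (R * Q)⁻¹ u ∈ A := by
              rw [hAiff _ _ (key _ _), mul_inv_rev, act_mul, ← hpu, hRi, map_smul]
              exact hstar _ ((hAiff _ _ (key _ _)).1 h) c hc0 hc1
            rw [Set.indicator_of_mem h, Set.indicator_of_mem h1]; rfl
          · simp [h]
      _ = ∫⁻ Q, A.indicator 1 (act Q⁻¹ u) ∂ν :=
          lintegral_mul_left_eq_self (μ := ν) (fun Q => A.indicator 1 (act Q⁻¹ u)) R
  · intro k hk hkK
    have h1 : ∀ Q, ∫⁻ u, k u * A.indicator 1 (act Q⁻¹ u) ∂μ = ∫⁻ u, k u * A.indicator 1 u ∂μ := by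
      intro Q
      conv_rhs => rw [← hinv (act Q⁻¹)]
      have hmm : Measurable fun u => k u * A.indicator (1 : E → ENNReal) u :=
        hk.mul (measurable_one.indicator hA)
      rw [lintegral_map hmm (act Q⁻¹).continuous.measurable]
      refine lintegral_congr fun u => ?_
      rw [hkK _ _ (act_sub Q⁻¹ u)]
    have hm : Measurable (fun p : E × fixGroup K => k p.1 * A.indicator 1 (act p.2⁻¹ p.1)) :=
      (hk.comp measurable_fst).mul hind
    calc ∫⁻ u, k u * A.indicator 1 u ∂μ
        = ∫⁻ _Q : fixGroup K, ∫⁻ u, k u * A.indicator 1 u ∂μ ∂ν := by simp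
      _ = ∫⁻ Q : fixGroup K, ∫⁻ u, k u * A.indicator 1 (act Q⁻¹ u) ∂μ ∂ν :=
          lintegral_congr fun Q => (h1 Q).symm
      _ = ∫⁻ u, ∫⁻ Q : fixGroup K, k u * A.indicator 1 (act Q⁻¹ u) ∂ν ∂μ :=
          (lintegral_lintegral_swap hm.aemeasurable).symm
      _ = _ := by
          refine lintegral_congr fun u => ?_
          have hmq : Measurable fun Q : fixGroup K => A.indicator (1 : E → ENNReal) (act Q⁻¹ u) :=
            (measurable_one.indicator hA).comp (hcu u).measurable
          exact lintegral_const_mul (k u) hmq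

lemma cheb {E : Type*} [MeasurableSpace E] (μ : Measure E) [IsProbabilityMeasure μ]
    (f g : E → ENNReal) (hf : Measurable f) (hg : Measurable g)
    (h : ∀ᵐ u ∂μ, ∀ᵐ v ∂μ, (f u ≤ f v ∧ g v ≤ g u) ∨ (f v ≤ f u ∧ g u ≤ g v)) :
    ∫⁻ u, f u * g u ∂μ ≤ (∫⁻ u, f u ∂μ) * ∫⁻ u, g u ∂μ := by
  have pt : ∀ a b c d : ENNReal, a ≤ b → d ≤ c → a * c + b * d ≤ a * d + b * c := by
    intro a b c d h1 h2
    obtain ⟨x, rfl⟩ := exists_add_of_le h1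
    obtain ⟨y, rfl⟩ := exists_add_of_le h2
    calc a * (d + y) + (a + x) * d ≤ (a * (d + y) + (a + x) * d) + x * y := le_self_add
      _ = _ := by ring
  have main : ∫⁻ u, ∫⁻ v, (f u * g u + f v * g v) ∂μ ∂μ ≤
      ∫⁻ u, ∫⁻ v, (f u * g v + f v * g u) ∂μ ∂μ := by
    refine lintegral_mono_ae ?_
    filter_upwards [h] with u hu
    refine lintegral_mono_ae ?_
    filter_upwards [hu] with v hv
    rcases hv with ⟨h1, h2⟩ | ⟨h1, h2⟩
    · exact pt _ _ _ _ h1 h2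
    · rw [add_comm, add_comm (f u * g v)]
      exact pt _ _ _ _ h1 h2
  have e1 : ∫⁻ u, ∫⁻ v, (f u * g u + f v * g v) ∂μ ∂μ = 2 * ∫⁻ u, f u * g u ∂μ := by
    simp_rw [lintegral_add_left measurable_const, lintegral_const, measure_univ, mul_one]
    have hfg : Measurable fun u => f u * g u := hf.mul hg
    rw [lintegral_add_left hfg, lintegral_const, measure_univ, mul_one, two_mul]
  have e2 : ∫⁻ u, ∫⁻ v, (f u * g v + f v * g u) ∂μ ∂μ =
      2 * ((∫⁻ u, f u ∂μ) * ∫⁻ u, g u ∂μ) := by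
    have : ∀ u, ∫⁻ v, (f u * g v + f v * g u) ∂μ =
        f u * (∫⁻ v, g v ∂μ) + (∫⁻ v, f v ∂μ) * g u := by
      intro u
      rw [lintegral_add_left (hg.const_mul _), lintegral_const_mul _ hg, lintegral_mul_const _ hf]
    simp_rw [this]
    rw [lintegral_add_left (hf.mul_const _), lintegral_const_mul _ hg, lintegral_mul_const _ hf,
      two_mul]
  rw [e1, e2] at main
  exact (ENNReal.mul_le_mul_iff_right (by simp) (by simp)).1 main

lemma subindep {E : Type*} [NormedAddCommGroup E] [InnerProductSpace ℝ E]
    [FiniteDimensional ℝ E] [MeasurableSpace E] [BorelSpace E]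
    (μ : Measure E) [IsProbabilityMeasure μ] (hinv : ∀ f : E ≃ₗᵢ[ℝ] E, μ.map f = μ)
    (hs : ∀ᵐ u ∂μ, ‖u‖ = 1)
    (K : Submodule ℝ E) (A B : Set E) (hA : MeasurableSet A) (hB : MeasurableSet B)
    (hAK : ∀ u v, u - v ∈ Kᗮ → u ∈ A → v ∈ A)
    (hBK : ∀ u v, u - v ∈ K → u ∈ B → v ∈ B)
    (hAstar : ∀ u ∈ A, ∀ c : ℝ, 0 ≤ c → c ≤ 1 → c • u ∈ A)
    (hBstar : ∀ u ∈ B, ∀ c : ℝ, 0 ≤ c → c ≤ 1 → c • u ∈ B) :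
    μ (A ∩ B) ≤ μ A * μ B := by
  classical
  obtain ⟨f, hf, hfm, hfa⟩ := exists_avg μ hinv K A hA hAK hAstar
  obtain ⟨g, hg, hgm, hga⟩ := exists_avg μ hinv Kᗮ B hB
    (by rwa [Submodule.orthogonal_orthogonal]) hBstar
  have hA1 : ∫⁻ u, f u ∂μ = μ A := by
    have := hfa (fun _ => 1) measurable_const (fun _ _ _ => rfl)
    simp only [one_mul] at this
    rw [← this, lintegral_indicator_one hA]
  have hB1 : ∫⁻ u, g u ∂μ = μ B := by
    have := hga (fun _ => 1) measurable_const (fun _ _ _ => rfl)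
    simp only [one_mul] at this
    rw [← this, lintegral_indicator_one hB]
  have hBind : ∀ u v, u - v ∈ K → B.indicator (1 : E → ENNReal) u = B.indicator 1 v := by
    intro u v h
    have h' : v - u ∈ K := by rw [← neg_sub]; exact Submodule.neg_mem _ h
    have : u ∈ B ↔ v ∈ B := ⟨hBK u v h, hBK v u h'⟩
    simp [Set.indicator, this]
  have hfc : ∀ u v, u - v ∈ Kᗮ → f u = f v := by
    intro u v h
    have : K.starProjection u = K.starProjection v := by
      rw [← sub_eq_zero, ← map_sub]
      exact (Submodule.starProjection_apply_eq_zero_iff K).2 h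
    exact le_antisymm (hfm _ _ (by rw [this])) (hfm _ _ (by rw [this]))
  have h1 := hfa (B.indicator 1) (measurable_one.indicator hB) hBind
  have h2 := hga f hf hfc
  have h0 : μ (A ∩ B) = ∫⁻ u, f u * g u ∂μ := by
    rw [← h2, ← lintegral_indicator_one (hA.inter hB)]
    rw [show (fun u => f u * B.indicator (1 : E → ENNReal) u) =
      fun u => B.indicator (1 : E → ENNReal) u * f u from funext fun u => mul_comm _ _, ← h1]
    refine lintegral_congr fun u => ?_
    by_cases ha : u ∈ A <;> by_cases hb : u ∈ B <;> simp [ha, hb]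
  rw [h0, ← hA1, ← hB1]
  refine cheb μ f g hf hg ?_
  filter_upwards [hs] with u hu
  filter_upwards [hs] with v hv
  have eu := Submodule.norm_sq_eq_add_norm_sq_starProjection u K
  have ev := Submodule.norm_sq_eq_add_norm_sq_starProjection v K
  rw [hu] at eu
  rw [hv] at ev
  rcases le_total ‖K.starProjection u‖ ‖K.starProjection v‖ with h | h
  · right
    refine ⟨hfm _ _ h, hgm _ _ ?_⟩
    have := pow_le_pow_left₀ (norm_nonneg _) h 2
    exact (pow_le_pow_iff_left₀ (norm_nonneg _) (norm_nonneg _) two_ne_zero).1 (by linarith)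
  · left
    refine ⟨hfm _ _ h, hgm _ _ ?_⟩
    have := pow_le_pow_left₀ (norm_nonneg _) h 2
    exact (pow_le_pow_iff_left₀ (norm_nonneg _) (norm_nonneg _) two_ne_zero).1 (by linarith)

lemma subindep_coord (n : ℕ) (μ : Measure (EuclideanSpace ℝ (Fin n)))
    [IsProbabilityMeasure μ]
    (hsphere : μ (Metric.sphere (0 : EuclideanSpace ℝ (Fin n)) 1) = 1)
    (hinv : ∀ f : EuclideanSpace ℝ (Fin n) ≃ₗᵢ[ℝ] EuclideanSpace ℝ (Fin n), μ.map f = μ)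
    (t : Fin n → ℝ) (ht : ∀ i, 0 < t i) (p q : Fin n → Prop) (hpq : ∀ i, p i → ¬ q i) :
    μ {u | ∀ i, p i ∨ q i → u i ≤ t i} ≤ μ {u | ∀ i, p i → u i ≤ t i} *
      μ {u | ∀ i, q i → u i ≤ t i} := by
  classical
  have hmeas : ∀ p : Fin n → Prop,
      MeasurableSet {u : EuclideanSpace ℝ (Fin n) | ∀ i, p i → u i ≤ t i} := by
    intro p
    simp only [Set.ofPred_forall]
    refine MeasurableSet.iInter fun i => MeasurableSet.iInter fun _ => ?_
    exact measurableSet_le (by fun_prop) measurable_const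
  have hstar : ∀ p : Fin n → Prop, ∀ u ∈ {u : EuclideanSpace ℝ (Fin n) | ∀ i, p i → u i ≤ t i},
      ∀ c : ℝ, 0 ≤ c → c ≤ 1 → c • u ∈ {u : EuclideanSpace ℝ (Fin n) | ∀ i, p i → u i ≤ t i} := by
    intro p u hu c hc0 hc1 i hi
    have h1 := hu i hi
    have h2 := ht i
    simp only [PiLp.smul_apply, smul_eq_mul]
    nlinarith
  have hs : ∀ᵐ u ∂μ, ‖u‖ = 1 := by
    have h := (prob_compl_eq_zero_iff (μ := μ) (Metric.isClosed_sphere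
      (x := (0 : EuclideanSpace ℝ (Fin n))) (ε := 1)).measurableSet).2 hsphere
    rw [ae_iff]
    convert h using 2
    ext u; simp
  let K : Submodule ℝ (EuclideanSpace ℝ (Fin n)) :=
    { carrier := {u | ∀ i, ¬ p i → u i = 0}
      add_mem' := by
        intro a b ha hb i hi
        simp [ha i hi, hb i hi]
      zero_mem' := by intro i _; simp
      smul_mem' := by
        intro c a ha i hi
        simp [ha i hi] }
  have key := subindep μ hinv hs K {u | ∀ i, p i → u i ≤ t i} {u | ∀ i, q i → u i ≤ t i}
    (hmeas p) (hmeas q) ?_ ?_ (hstar p) (hstar q)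
  · refine le_trans (le_of_eq ?_) key
    congr 1
    ext u
    simp only [Set.mem_ofPred_eq, Set.mem_inter_iff, or_imp, forall_and]
  · intro u v huv hu i hi
    have hmem : EuclideanSpace.single i (1 : ℝ) ∈ K := by
      intro j hj
      have : j ≠ i := fun h => hj (h ▸ hi)
      simp [this]
    have := huv _ hmem
    simp [EuclideanSpace.inner_single_left] at this
    have h1 := hu i hi
    linarith
  · intro u v huv hu i hi
    have := huv i (fun h => hpq i h hi)
    simp at this
    have h1 := hu i hi
    linarith

/-- Proposition A.1 (subindependence of coordinate halfspaces): let `μ` be the uniform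
(rotation-invariant) probability measure on the unit sphere `S^{n-1} ⊂ ℝ^n`, formalized as a
probability measure on `ℝ^n` concentrated on the unit sphere and invariant under every linear
isometry.  Then for `1 ≤ r < n` and positive reals `t_1,…,t_n`,
`μ(⋂_{i=1}^n {u_i ≤ t_i}) ≤ μ(⋂_{i≤r} {u_i ≤ t_i}) μ(⋂_{i>r} {u_i ≤ t_i})`, and consequently
`μ(⋂_{i=1}^n {u_i ≤ t_i}) ≤ ∏_i μ({u_i ≤ t_i})`. -/
theorem stmt19 (n : ℕ) (hn : 2 ≤ n) (μ : Measure (EuclideanSpace ℝ (Fin n)))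
    (hprob : IsProbabilityMeasure μ)
    (hsphere : μ (Metric.sphere (0 : EuclideanSpace ℝ (Fin n)) 1) = 1)
    (hinv : ∀ f : EuclideanSpace ℝ (Fin n) ≃ₗᵢ[ℝ] EuclideanSpace ℝ (Fin n), μ.map f = μ)
    (t : Fin n → ℝ) (ht : ∀ i, 0 < t i) :
    (∀ r : ℕ, 1 ≤ r → r < n →
      μ {u | ∀ i, u i ≤ t i} ≤
        μ {u | ∀ i : Fin n, (i : ℕ) < r → u i ≤ t i} *
          μ {u | ∀ i : Fin n, r ≤ (i : ℕ) → u i ≤ t i}) ∧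
    μ {u | ∀ i, u i ≤ t i} ≤ ∏ i, μ {u | u i ≤ t i} := by
  constructor
  · intro r _ _
    have := subindep_coord n μ hsphere hinv t ht (fun i => (i : ℕ) < r) (fun i => r ≤ (i : ℕ))
      (fun i h => not_le.2 h)
    refine le_trans (le_of_eq ?_) this
    congr 1
    ext u
    simp [lt_or_ge]
  · have key : ∀ S : Finset (Fin n),
        μ {u | ∀ i, i ∈ S → u i ≤ t i} ≤ ∏ i ∈ S, μ {u | u i ≤ t i} := by
      intro S
      induction S using Finset.induction_on with
      | empty => simp
      | insert a S ha ih =>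
        rw [Finset.prod_insert ha]
        have := subindep_coord n μ hsphere hinv t ht (fun i => i = a) (fun i => i ∈ S)
          (fun i h => h ▸ ha)
        simp only [Finset.mem_insert]
        refine this.trans ?_
        simp only [forall_eq]
        gcongr
    simpa using key Finset.univ
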